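/- Theorem 2, part (ii) (existence witness, Example 1): let C1 be the definite clause f(A,B) ← inv(A,C), inv(C,B), let C2 be the definite clause inv(A,B) ← tail(A,C), tail(C,B), let CQ be the definite clause f(A,B) ← reverse(A,B), let P = {C1, C2} and Q = P ∪ {CQ}. Then the clause C2 P-specialises Q, but Q is not separable. Hence there exist redundant hypotheses that are not separable, so redundancy constraints prune strictly more hypotheses than elimination constraints (which only prune separable hypotheses containing specialisations of a totally incomplete hypothesis). -/

import Mathlib

open FirstOrder Language Structure

/-- A first-order literal: a sign together with a relation symbol applied to terms. -/
structure Lit (L : Language) (V : Type) where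
  pos : Bool
  n : ℕ
  R : L.Relations n
  args : Fin n → L.Term V

namespace Lit

/-- Apply a substitution (mapping variables to terms) to a literal. -/
def subst {L : Language} {V : Type} (l : Lit L V) (θ : V → L.Term V) : Lit L V :=
  ⟨l.pos, l.n, l.R, fun i => (l.args i).subst θ⟩

/-- Truth of a literal in a structure under a variable assignment. -/
def Holds {L : Language} {V : Type} {M : Type} [L.Structure M] (v : V → M) (l : Lit L V) :
    Prop :=
  if l.pos then RelMap l.R (fun i => (l.args i).realize v)
  else ¬ RelMap l.R (fun i => (l.args i).realize v)

/-- The predicate symbol (with its arity) of a literal. -/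
def predSym {L : Language} {V : Type} (l : Lit L V) : Σ n, L.Relations n := ⟨l.n, l.R⟩

end Lit

/-- A clause is a (finite) set of literals, interpreted as the universal closure of the
disjunction of its literals. -/
abbrev Clause (L : Language) (V : Type) := Set (Lit L V)

namespace Clause

/-- Apply a substitution to every literal of a clause. -/
def subst {L : Language} {V : Type} (C : Clause L V) (θ : V → L.Term V) : Clause L V :=
  (fun l => l.subst θ) '' C

/-- A structure `M` is a model of clause `C`: for every assignment of the (universally
quantified) variables, some literal of `C` is true. -/
def SatisfiedIn {L : Language} {V : Type} (C : Clause L V) (M : Type) [L.Structure M] : Prop :=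
  ∀ v : V → M, ∃ l ∈ C, l.Holds v

/-- A definite clause has exactly one positive literal. -/
def Definite {L : Language} {V : Type} (C : Clause L V) : Prop :=
  ∃! l, l ∈ C ∧ l.pos = true

end Clause

/-- Clause `C₁` subsumes clause `C₂`: there is a substitution `θ` with `C₁θ ⊆ C₂`. -/
def Subsumes {L : Language} {V : Type} (C₁ C₂ : Clause L V) : Prop :=
  ∃ θ : V → L.Term V, C₁.subst θ ⊆ C₂

/-- Theory `T₁` subsumes theory `T₂`: every clause of `T₂` is subsumed by some clause of `T₁`. -/
def TheorySubsumes {L : Language} {V : Type} (T₁ T₂ : Set (Clause L V)) : Prop :=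
  ∀ C₂ ∈ T₂, ∃ C₁ ∈ T₁, Subsumes C₁ C₂

/-- A structure `M` is a model of a clausal theory `T`. -/
def ClModels {L : Language} {V : Type} (M : Type) [L.Structure M] (T : Set (Clause L V)) :
    Prop :=
  ∀ C ∈ T, C.SatisfiedIn M

/-- Semantic entailment between clausal theories: every model of `T₁` is a model of `T₂`. -/
def ClEntails {L : Language} {V : Type} (T₁ T₂ : Set (Clause L V)) : Prop :=
  ∀ (M : Type) [L.Structure M], ClModels M T₁ → ClModels M T₂

/-- A ground atom: a relation symbol applied to closed (variable-free) terms. -/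
structure GAtom (L : Language) where
  n : ℕ
  R : L.Relations n
  args : Fin n → L.Term Empty

/-- Truth of a ground atom in a structure. -/
def GAtom.Holds {L : Language} (e : GAtom L) (M : Type) [L.Structure M] : Prop :=
  RelMap e.R (fun i => (e.args i).realize (fun x : Empty => (x.elim : M)))

/-- A clausal theory `T` entails a ground atom `e`: `e` holds in every model of `T`. -/
def EntailsAtom {L : Language} {V : Type} (T : Set (Clause L V)) (e : GAtom L) : Prop :=
  ∀ (M : Type) [L.Structure M], ClModels M T → e.Holds M

/-- A definite program is a finite set of finite definite clauses. -/
def DefiniteProgram {L : Language} {V : Type} (P : Set (Clause L V)) : Prop :=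
  P.Finite ∧ ∀ C ∈ P, C.Finite ∧ C.Definite

/-- The predicate symbols occurring in the head (positive literals) of a clause. -/
def headPreds {L : Language} {V : Type} (C : Clause L V) : Set (Σ n, L.Relations n) :=
  {p | ∃ l ∈ C, l.pos = true ∧ l.predSym = p}

/-- The predicate symbols occurring in the body (negative literals) of a clause. -/
def bodyPreds {L : Language} {V : Type} (C : Clause L V) : Set (Σ n, L.Relations n) :=
  {p | ∃ l ∈ C, l.pos = false ∧ l.predSym = p}

/-- Edge of the dependency graph of program `P`: there is an edge from `C₁` to `C₂` when the
head predicate symbol of `C₂` occurs in the body of `C₁`. -/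
def DepEdge {L : Language} {V : Type} (P : Set (Clause L V)) (C₁ C₂ : Clause L V) : Prop :=
  C₁ ∈ P ∧ C₂ ∈ P ∧ ∃ p, p ∈ headPreds C₂ ∧ p ∈ bodyPreds C₁

/-- `C₁` depends on `C₂` in `P`: there is a directed path from `C₁` to `C₂` in the
dependency graph of `P`. -/
def Depends {L : Language} {V : Type} (P : Set (Clause L V)) : Clause L V → Clause L V → Prop :=
  Relation.TransGen (DepEdge P)

/-- `P' = {C ∈ Q | ∃ D ∈ P, D ⪯ C}`: the clauses of `Q` subsumed by some clause of `P`. -/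
def specSet {L : Language} {V : Type} (P Q : Set (Clause L V)) : Set (Clause L V) :=
  {C | C ∈ Q ∧ ∃ D ∈ P, Subsumes D C}

/-- A clause `C` `P`-specialises `Q`: `C ∈ P' = {C ∈ Q | ∃ D ∈ P, D ⪯ C}`, `C` does not depend
on any clause in `Q \ P'`, and no clause in `Q \ P'` depends on `C`. -/
def PSpecialises {L : Language} {V : Type} (P Q : Set (Clause L V)) (C : Clause L V) : Prop :=
  C ∈ specSet P Q ∧
    (∀ C' ∈ Q \ specSet P Q, ¬ Depends Q C C') ∧
    (∀ C' ∈ Q \ specSet P Q, ¬ Depends Q C' C)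

/-- A hypothesis is separable when no predicate symbol in the head of a clause occurs
in the body of a clause. -/
def Separable {L : Language} {V : Type} (H : Set (Clause L V)) : Prop :=
  ∀ C₁ ∈ H, ∀ C₂ ∈ H, ∀ p, p ∈ headPreds C₁ → p ∉ bodyPreds C₂

/-- The cost of a hypothesis: its total number of literals. -/
noncomputable def cost {L : Language} {V : Type} (H : Set (Clause L V)) : ℕ :=
  ∑ᶠ C ∈ H, C.ncard

/-- Complete: `B ∪ H` entails every positive example. -/
def Complete {L : Language} {V : Type} (B H : Set (Clause L V)) (Ep : Set (GAtom L)) : Prop :=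
  ∀ e ∈ Ep, EntailsAtom (B ∪ H) e

/-- Consistent: `B ∪ H` entails no negative example. -/
def Consistent' {L : Language} {V : Type} (B H : Set (Clause L V)) (En : Set (GAtom L)) : Prop :=
  ∀ e ∈ En, ¬ EntailsAtom (B ∪ H) e

/-- A solution is a complete and consistent hypothesis. -/
def IsSolution {L : Language} {V : Type} (B : Set (Clause L V)) (Ep En : Set (GAtom L))
    (H : Set (Clause L V)) : Prop :=
  Complete B H Ep ∧ Consistent' B H En

/-- Totally incomplete: `B ∪ H` entails no positive example. -/
def TotallyIncomplete {L : Language} {V : Type} (B H : Set (Clause L V))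
    (Ep : Set (GAtom L)) : Prop :=
  ∀ e ∈ Ep, ¬ EntailsAtom (B ∪ H) e

/-- An optimal solution: a solution of minimal cost among all definite-program solutions. -/
def OptimalSolution {L : Language} {V : Type} (B : Set (Clause L V)) (Ep En : Set (GAtom L))
    (H : Set (Clause L V)) : Prop :=
  IsSolution B Ep En H ∧
    ∀ H' : Set (Clause L V), DefiniteProgram H' → IsSolution B Ep En H' → cost H ≤ cost H'

/-! STATEMENT 9 (Theorem 2, part (ii); Example 1): a concrete witness of a redundant but
non-separable hypothesis. -/

/-- The binary predicate symbols `f`, `inv`, `tail`, `reverse`. -/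
inductive PSym9 : Type
  | f | inv | tail | reverse
  deriving DecidableEq

/-- A language with exactly the four binary predicate symbols and no function symbols. -/
def L9 : Language where
  Functions := fun _ => Empty
  Relations := fun n => match n with
    | 2 => PSym9
    | _ => Empty

/-- The variables `A`, `B`, `C`. -/
inductive Var9 : Type
  | A | B | C
  deriving DecidableEq

open Term in
/-- `C₁ = f(A,B) ← inv(A,C), inv(C,B)`. -/
def Ex1C1 : Clause L9 Var9 :=
  {⟨true, 2, (PSym9.f : L9.Relations 2), ![var Var9.A, var Var9.B]⟩,
   ⟨false, 2, (PSym9.inv : L9.Relations 2), ![var Var9.A, var Var9.C]⟩,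
   ⟨false, 2, (PSym9.inv : L9.Relations 2), ![var Var9.C, var Var9.B]⟩}

open Term in
/-- `C₂ = inv(A,B) ← tail(A,C), tail(C,B)`. -/
def Ex1C2 : Clause L9 Var9 :=
  {⟨true, 2, (PSym9.inv : L9.Relations 2), ![var Var9.A, var Var9.B]⟩,
   ⟨false, 2, (PSym9.tail : L9.Relations 2), ![var Var9.A, var Var9.C]⟩,
   ⟨false, 2, (PSym9.tail : L9.Relations 2), ![var Var9.C, var Var9.B]⟩}

open Term in
/-- `C_Q = f(A,B) ← reverse(A,B)`. -/
def Ex1CQ : Clause L9 Var9 :=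
  {⟨true, 2, (PSym9.f : L9.Relations 2), ![var Var9.A, var Var9.B]⟩,
   ⟨false, 2, (PSym9.reverse : L9.Relations 2), ![var Var9.A, var Var9.B]⟩}

/-- `P = {C₁, C₂}`. -/
def Ex1P : Set (Clause L9 Var9) := {Ex1C1, Ex1C2}

/-- `Q = P ∪ {C_Q}`. -/
def Ex1Q : Set (Clause L9 Var9) := Ex1P ∪ {Ex1CQ}

theorem FirstOrder.Language.Term.subst_var {L : Language} {V : Type} (t : L.Term V) :
    t.subst Term.var = t := by
  induction t with
  | var => rfl
  | func f ts ih => simp only [Term.subst, ih]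

theorem Lit.subst_var {L : Language} {V : Type} (l : Lit L V) : l.subst Term.var = l := by
  simp only [Lit.subst, Term.subst_var]

theorem Subsumes.refl {L : Language} {V : Type} (C : Clause L V) : Subsumes C C := by
  refine ⟨Term.var, ?_⟩
  rintro _ ⟨l, hl, rfl⟩
  simpa only [Lit.subst_var] using hl

theorem mem_specSet_of_mem {L : Language} {V : Type} {P Q : Set (Clause L V)} {C : Clause L V}
    (hQ : C ∈ Q) (hP : C ∈ P) : C ∈ specSet P Q :=
  ⟨hQ, C, hP, Subsumes.refl C⟩

/-- A clause whose body uses no head predicate of the program depends on no clause. -/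
theorem not_depends_of_disjoint {L : Language} {V : Type} {Q : Set (Clause L V)}
    {C : Clause L V} (h : ∀ D ∈ Q, Disjoint (headPreds D) (bodyPreds C)) (D : Clause L V) :
    ¬ Depends Q C D := by
  intro hD
  obtain ⟨E, ⟨-, hE, p, hp, hp'⟩, -⟩ := Relation.TransGen.head'_iff.mp hD
  exact Set.disjoint_left.mp (h E hE) hp hp'

/-- The predicate symbol of the language `L9` given by an element of `PSym9`. -/
def PSym9.sym (s : PSym9) : Σ n, L9.Relations n := ⟨2, s⟩

theorem PSym9.sym_injective : Function.Injective PSym9.sym := fun _ _ h =>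
  eq_of_heq (Sigma.mk.inj h).2

theorem headPreds_Ex1C1 : headPreds Ex1C1 = {PSym9.f.sym} := by
  ext p
  simp [headPreds, Ex1C1, Lit.predSym, PSym9.sym]

theorem headPreds_Ex1C2 : headPreds Ex1C2 = {PSym9.inv.sym} := by
  ext p
  simp [headPreds, Ex1C2, Lit.predSym, PSym9.sym]

theorem headPreds_Ex1CQ : headPreds Ex1CQ = {PSym9.f.sym} := by
  ext p
  simp [headPreds, Ex1CQ, Lit.predSym, PSym9.sym]

theorem bodyPreds_Ex1C1 : bodyPreds Ex1C1 = {PSym9.inv.sym} := by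
  ext p
  simp [bodyPreds, Ex1C1, Lit.predSym, PSym9.sym]

theorem bodyPreds_Ex1C2 : bodyPreds Ex1C2 = {PSym9.tail.sym} := by
  ext p
  simp [bodyPreds, Ex1C2, Lit.predSym, PSym9.sym]

theorem bodyPreds_Ex1CQ : bodyPreds Ex1CQ = {PSym9.reverse.sym} := by
  ext p
  simp [bodyPreds, Ex1CQ, Lit.predSym, PSym9.sym]

theorem Ex1C1_mem_Ex1P : Ex1C1 ∈ Ex1P := Or.inl rfl

theorem Ex1C2_mem_Ex1P : Ex1C2 ∈ Ex1P := Or.inr rfl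

theorem disjoint_headPreds_bodyPreds_Ex1C2 :
    ∀ D ∈ Ex1Q, Disjoint (headPreds D) (bodyPreds Ex1C2) := by
  rintro D ((rfl | rfl) | rfl) <;>
    simp [headPreds_Ex1C1, headPreds_Ex1C2, headPreds_Ex1CQ, bodyPreds_Ex1C2,
      PSym9.sym_injective.eq_iff]

theorem disjoint_headPreds_bodyPreds_Ex1CQ :
    ∀ D ∈ Ex1Q, Disjoint (headPreds D) (bodyPreds Ex1CQ) := by
  rintro D ((rfl | rfl) | rfl) <;>
    simp [headPreds_Ex1C1, headPreds_Ex1C2, headPreds_Ex1CQ, bodyPreds_Ex1CQ,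
      PSym9.sym_injective.eq_iff]

theorem pSpecialises_Ex1C2 : PSpecialises Ex1P Ex1Q Ex1C2 := by
  refine ⟨mem_specSet_of_mem (Or.inl Ex1C2_mem_Ex1P) Ex1C2_mem_Ex1P,
    fun C _ => not_depends_of_disjoint disjoint_headPreds_bodyPreds_Ex1C2 C, ?_⟩
  rintro C ⟨hC | rfl, hC'⟩
  · exact absurd (mem_specSet_of_mem (Or.inl hC) hC) hC'
  · exact not_depends_of_disjoint disjoint_headPreds_bodyPreds_Ex1CQ _

theorem not_separable_Ex1Q : ¬ Separable Ex1Q := fun h =>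
  h Ex1C2 (Or.inl Ex1C2_mem_Ex1P) Ex1C1 (Or.inl Ex1C1_mem_Ex1P) PSym9.inv.sym
    (by simp [headPreds_Ex1C2]) (by simp [bodyPreds_Ex1C1])

/-- the clause `C₂` `P`-specialises `Q`, but `Q` is not separable. Hence there
exist redundant hypotheses that are not separable. -/
theorem example1_redundant_not_separable :
    PSpecialises Ex1P Ex1Q Ex1C2 ∧ ¬ Separable Ex1Q ∧
      ∃ (P Q : Set (Clause L9 Var9)) (C : Clause L9 Var9),
        PSpecialises P Q C ∧ ¬ Separable Q := by
  exact ⟨pSpecialises_Ex1C2, not_separable_Ex1Q,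
    Ex1P, Ex1Q, Ex1C2, pSpecialises_Ex1C2, not_separable_Ex1Q⟩
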